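/- For every integer m, the generating function for partitions with rank exactly m satisfies P_m(q) = (1/(q;q)_∞) Σ_{j≥1} (−1)^{j−1} (1−q^j) q^{j(3j−1)/2 + |m|j}. -/

import Mathlib

namespace Dyson

/-- The rank of a partition: largest part minus number of parts. -/
def rank {n : ℕ} (π : n.Partition) : ℤ :=
  (π.parts.sup : ℤ) - π.parts.card

/-- The Euler product `(q;q)_∞`. -/
noncomputable def euler (q : ℝ) : ℝ := ∏' j : ℕ, (1 - q ^ (j + 1))

/-- `Q_m(q)`: generating function for nonempty partitions of rank ≥ m. -/
noncomputable def Q (q : ℝ) (m : ℤ) : ℝ :=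
  ∑' n : ℕ, (Nat.card {π : (n + 1).Partition // m ≤ rank π} : ℝ) * q ^ (n + 1)

noncomputable def qPoch (q : ℝ) (n : ℕ) : ℝ := ∏ j ∈ Finset.range n, (1 - q ^ (j + 1))

noncomputable def qbinom (q : ℝ) (a b : ℤ) : ℝ :=
  if 0 ≤ b ∧ b ≤ a then qPoch q a.toNat / (qPoch q b.toNat * qPoch q (a - b).toNat) else 0

noncomputable def QL (q : ℝ) (m L : ℤ) : ℝ :=
  ∑' n : ℕ,
    (Nat.card {π : (n + 1).Partition // m ≤ rank π ∧ (π.parts.sup : ℤ) ≤ L} : ℝ) * q ^ (n + 1)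

def partAt {n : ℕ} (π : n.Partition) (j : ℕ) : ℕ :=
  ((π.parts.sort (· ≤ ·)).reverse.getD j 0)

def inRankSet {n : ℕ} (π : n.Partition) (k : ℤ) : Prop :=
  ∃ j : ℕ, (j : ℤ) - partAt π (j + 1) = k

noncomputable def G (q : ℝ) (k : ℤ) : ℝ :=
  ∑' n : ℕ, (Nat.card {π : n.Partition // inRankSet π k} : ℝ) * q ^ n

def crank {n : ℕ} (π : n.Partition) : ℤ :=
  if π.parts.count 1 = 0 then (π.parts.sup : ℤ)
  else ((π.parts.filter (fun p => π.parts.count 1 < p)).card : ℤ) - π.parts.count 1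


/-- `P_m(q)`: generating function for partitions with rank exactly `m`. -/
noncomputable def P (q : ℝ) (m : ℤ) : ℝ :=
  ∑' n : ℕ, (Nat.card {π : (n + 1).Partition // rank π = m} : ℝ) * q ^ (n + 1)

/-- Strip the first column and insert a part `c`. -/
def fM (c : ℕ) (s : Multiset ℕ) : Multiset ℕ :=
  (s.map Nat.pred).filter (· ≠ 0) + (if c = 0 then 0 else {c})

/-- Remove the largest part and add a first column of length `k`. -/
def gM (k : ℕ) (s : Multiset ℕ) : Multiset ℕ :=
  (s.erase s.sup).map Nat.succ + Multiset.replicate (k - (s.erase s.sup).card) 1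

lemma sum_pred (s : Multiset ℕ) (hs : ∀ i ∈ s, 0 < i) :
    ((s.map Nat.pred).filter (· ≠ 0)).sum + s.card = s.sum := by
  induction s using Multiset.induction with
  | empty => simp
  | cons a s ih =>
    have h1 := ih (fun i hi => hs i (Multiset.mem_cons_of_mem hi))
    have h2 := hs a (Multiset.mem_cons_self a s)
    rw [Multiset.map_cons, Multiset.filter_cons]
    by_cases h : a.pred = 0
    · simp only [h, ne_eq, not_true_eq_false, if_false, Multiset.card_cons, Multiset.sum_cons,
        zero_add]
      simp only [Nat.pred_eq_sub_one, ne_eq] at *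
      omega
    · simp only [h, ne_eq, not_false_eq_true, if_true, Multiset.card_cons, Multiset.sum_cons,
        Multiset.sum_add, Multiset.sum_singleton]
      simp only [Nat.pred_eq_sub_one, ne_eq] at *
      omega

lemma sum_succ (s : Multiset ℕ) : (s.map Nat.succ).sum = s.sum + s.card := by
  induction s using Multiset.induction with
  | empty => simp
  | cons a s ih => simp [ih]; omega

lemma fM_sum (c : ℕ) (s : Multiset ℕ) (hs : ∀ i ∈ s, 0 < i) :
    (fM c s).sum + s.card = s.sum + c := by
  have := sum_pred s hs
  unfold fM
  split_ifs with h
  · simp only [Multiset.sum_add, Multiset.sum_zero]; omega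
  · simp only [Multiset.sum_add, Multiset.sum_singleton]; omega

lemma fM_pos (c : ℕ) (s : Multiset ℕ) : ∀ i ∈ fM c s, 0 < i := by
  intro i hi
  unfold fM at hi
  rw [Multiset.mem_add] at hi
  rcases hi with hi | hi
  · exact Nat.pos_of_ne_zero (Multiset.mem_filter.1 hi).2
  · split_ifs at hi with h
    · simp at hi
    · simp at hi; omega

lemma filt_le (c : ℕ) (s : Multiset ℕ) (hc : s.sup ≤ c + 1) :
    ∀ i ∈ (s.map Nat.pred).filter (· ≠ 0), i ≤ c := by
  intro i hi
  obtain ⟨j, hj, rfl⟩ := Multiset.mem_map.1 (Multiset.mem_filter.1 hi).1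
  have := Multiset.le_sup hj
  simp only [Nat.pred_eq_sub_one]; omega

lemma filt_zero (s : Multiset ℕ) (hc : s.sup ≤ 0 + 1) :
    (s.map Nat.pred).filter (· ≠ 0) = 0 := by
  rw [Multiset.eq_zero_iff_forall_notMem]
  intro i hi
  have := filt_le 0 s hc i hi
  exact (Multiset.mem_filter.1 hi).2 (by omega)

lemma fM_sup (c : ℕ) (s : Multiset ℕ) (hc : s.sup ≤ c + 1) : (fM c s).sup = c := by
  have := Multiset.sup_le.2 (filt_le c s hc)
  unfold fM
  split_ifs with h
  · subst h; rw [Multiset.sup_add]; simpa using this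
  · rw [Multiset.sup_add, Multiset.sup_singleton]; simpa using this

lemma fM_card_le (c : ℕ) (s : Multiset ℕ) : (fM c s).card ≤ s.card + 1 := by
  have : ((s.map Nat.pred).filter (· ≠ 0)).card ≤ s.card := by
    simpa using Multiset.card_le_card (Multiset.filter_le (· ≠ 0) (s.map Nat.pred))
  unfold fM
  split_ifs with h <;> simp only [Multiset.card_add, Multiset.card_zero, Multiset.card_singleton] <;> omega

lemma fM_zero (s : Multiset ℕ) (hc : s.sup ≤ 0 + 1) : fM 0 s = 0 := by
  unfold fM; rw [filt_zero s hc]; simp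

lemma fM_erase (c : ℕ) (s : Multiset ℕ) (hc : s.sup ≤ c + 1) :
    (fM c s).erase (fM c s).sup = (s.map Nat.pred).filter (· ≠ 0) := by
  rw [fM_sup c s hc]
  by_cases h : c = 0
  · subst h; rw [fM_zero s hc, filt_zero s hc]; simp
  · unfold fM; rw [if_neg h, add_comm, Multiset.singleton_add, Multiset.erase_cons_head]

lemma succ_filt (s : Multiset ℕ) (hs : ∀ i ∈ s, 0 < i) :
    ((s.map Nat.pred).filter (· ≠ 0)).map Nat.succ +
      Multiset.replicate (s.card - ((s.map Nat.pred).filter (· ≠ 0)).card) 1 = s := by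
  induction s using Multiset.induction with
  | empty => simp
  | cons a s ih =>
    have h1 := ih (fun i hi => hs i (Multiset.mem_cons_of_mem hi))
    have h2 := hs a (Multiset.mem_cons_self a s)
    have h3 : ((s.map Nat.pred).filter (· ≠ 0)).card ≤ s.card := by
      simpa using Multiset.card_le_card (Multiset.filter_le (· ≠ 0) (s.map Nat.pred))
    rw [Multiset.map_cons]
    by_cases h : a.pred = 0
    · rw [Multiset.filter_cons_of_neg (p := (· ≠ 0)) _ (by simpa using h)]
      have : a = 1 := by simp only [Nat.pred_eq_sub_one] at h; omega
      rw [Multiset.card_cons, Nat.succ_sub h3, Multiset.replicate_succ, Multiset.add_cons, h1, this]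
    · rw [Multiset.filter_cons_of_pos (p := (· ≠ 0)) _ h]
      rw [Multiset.card_cons, Multiset.card_cons, Nat.add_sub_add_right, Multiset.map_cons,
        Multiset.cons_add, h1, Nat.succ_pred_eq_of_pos h2]

lemma gM_fM (c : ℕ) (s : Multiset ℕ) (hs : ∀ i ∈ s, 0 < i) (hc : s.sup ≤ c + 1) :
    gM s.card (fM c s) = s := by
  unfold gM
  rw [fM_erase c s hc, succ_filt s hs]

lemma sup_mem (s : Multiset ℕ) (h : s ≠ 0) : s.sup ∈ s := by
  induction s using Multiset.induction with
  | empty => simp at h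
  | cons a s ih =>
    rw [Multiset.sup_cons]
    by_cases hs : s = 0
    · subst hs; simp
    · rcases le_total a s.sup with h' | h'
      · rw [sup_eq_right.2 h']; exact Multiset.mem_cons_of_mem (ih hs)
      · rw [sup_eq_left.2 h']; exact Multiset.mem_cons_self a s

lemma fM_gM (k : ℕ) (s : Multiset ℕ) (hs : ∀ i ∈ s, 0 < i) :
    fM s.sup (gM k s) = s := by
  unfold fM gM
  have h1 : ∀ e : Multiset ℕ, (e.map Nat.succ).map Nat.pred = e := by
    intro e; rw [Multiset.map_map]; simp
  rw [Multiset.map_add, h1, Multiset.map_replicate, Multiset.filter_add]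
  have h2 : (s.erase s.sup).filter (· ≠ 0) = s.erase s.sup :=
    Multiset.filter_eq_self.2 (fun i hi => (hs i (Multiset.mem_of_mem_erase hi)).ne')
  have h3 : ∀ t, (Multiset.replicate t (Nat.pred 1)).filter (· ≠ 0) = 0 := by
    intro t
    rw [Multiset.filter_eq_nil]
    intro a ha; rw [Multiset.eq_of_mem_replicate ha]; simp
  rw [h2, h3, add_zero]
  by_cases h : s = 0
  · subst h; simp
  · have := hs _ (sup_mem s h)
    rw [if_neg this.ne', add_comm, Multiset.singleton_add, Multiset.cons_erase (sup_mem s h)]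

lemma erase_card_le (s : Multiset ℕ) : (s.erase s.sup).card = s.card - 1 := by
  by_cases h : s = 0
  · subst h; simp
  · rw [Multiset.card_erase_of_mem (sup_mem s h)]; rfl

lemma gM_card (k : ℕ) (s : Multiset ℕ) (h : s.card ≤ k + 1) : (gM k s).card = k := by
  unfold gM
  have := erase_card_le s
  rw [Multiset.card_add, Multiset.card_map, Multiset.card_replicate]; omega

lemma gM_pos (k : ℕ) (s : Multiset ℕ) : ∀ i ∈ gM k s, 0 < i := by
  intro i hi
  unfold gM at hi
  rw [Multiset.mem_add] at hi
  rcases hi with hi | hi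
  · obtain ⟨j, -, rfl⟩ := Multiset.mem_map.1 hi; simp
  · rw [Multiset.eq_of_mem_replicate hi]; simp

lemma gM_sup (k : ℕ) (s : Multiset ℕ) : (gM k s).sup ≤ s.sup + 1 := by
  rw [Multiset.sup_le]
  intro i hi
  unfold gM at hi
  rw [Multiset.mem_add] at hi
  rcases hi with hi | hi
  · obtain ⟨j, hj, rfl⟩ := Multiset.mem_map.1 hi
    have := Multiset.le_sup (Multiset.mem_of_mem_erase hj)
    simp only [Nat.succ_eq_add_one]; omega
  · rw [Multiset.eq_of_mem_replicate hi]; simp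

lemma gM_sum (k : ℕ) (s : Multiset ℕ) (h : s.card ≤ k + 1) :
    (gM k s).sum + s.sup = s.sum + k := by
  have h0 := erase_card_le s
  have h1 : (s.erase s.sup).sum + s.sup = s.sum := by
    by_cases h : s = 0
    · subst h; simp
    · rw [add_comm]; exact Multiset.sum_erase (sup_mem s h)
  unfold gM
  rw [Multiset.sum_add, sum_succ, Multiset.sum_replicate, smul_eq_mul]; omega

/-- Dyson's bijection. -/
lemma dyson_bij (n k : ℕ) (m : ℤ) (h : (k : ℤ) = n + m + 1) :
    Nat.card {π : n.Partition // (π.parts.sup : ℤ) ≤ π.parts.card + m + 2 ∧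
        0 ≤ (π.parts.card : ℤ) + m + 1} =
      Nat.card {π : k.Partition // (π.parts.card : ℤ) + m ≤ π.parts.sup ∧
        0 ≤ (π.parts.sup : ℤ) - m - 1} := by
  have key1 : ∀ π : n.Partition, ((π.parts.sup : ℤ) ≤ π.parts.card + m + 2 ∧
      0 ≤ (π.parts.card : ℤ) + m + 1) →
      π.parts.sup ≤ ((π.parts.card : ℤ) + m + 1).toNat + 1 := by
    intro π hπ; omega
  refine Nat.card_congr
    { toFun := fun π => ⟨⟨fM ((π.1.parts.card : ℤ) + m + 1).toNat π.1.parts,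
        fun {i} hi => fM_pos _ _ i hi, ?_⟩, ?_⟩
      invFun := fun π => ⟨⟨gM ((π.1.parts.sup : ℤ) - m - 1).toNat π.1.parts,
        fun {i} hi => gM_pos _ _ i hi, ?_⟩, ?_⟩
      left_inv := ?_
      right_inv := ?_ }
  · have h1 := fM_sum ((π.1.parts.card : ℤ) + m + 1).toNat π.1.parts (fun i hi => π.1.parts_pos hi)
    have h2 := π.1.parts_sum
    have h3 := π.2
    omega
  · have h1 := fM_sup _ _ (key1 π.1 π.2)
    have h2 := fM_card_le ((π.1.parts.card : ℤ) + m + 1).toNat π.1.parts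
    have h3 := π.2
    have h4 := key1 π.1 π.2
    dsimp only
    generalize hc : ((π.1.parts.card : ℤ) + m + 1).toNat = c at *
    by_cases h0 : c = 0
    · subst h0
      rw [fM_zero _ h4]
      simp
      omega
    · rw [h1]
      omega
  · have h1 := gM_sum ((π.1.parts.sup : ℤ) - m - 1).toNat π.1.parts (by have := π.2; omega)
    have h2 := π.1.parts_sum
    have h3 := π.2
    omega
  · have h1 := gM_sup ((π.1.parts.sup : ℤ) - m - 1).toNat π.1.parts
    have h2 := gM_card ((π.1.parts.sup : ℤ) - m - 1).toNat π.1.parts (by have := π.2; omega)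
    have h3 := π.2
    dsimp only
    rw [h2]
    omega
  · intro π
    apply Subtype.ext
    apply Nat.Partition.ext
    dsimp only
    rw [fM_sup _ _ (key1 π.1 π.2)]
    have : ((((π.1.parts.card : ℤ) + m + 1).toNat : ℤ) - m - 1).toNat = π.1.parts.card := by
      have := π.2; omega
    rw [this, gM_fM _ _ (fun i hi => π.1.parts_pos hi) (key1 π.1 π.2)]
  · intro π
    apply Subtype.ext
    apply Nat.Partition.ext
    dsimp only
    rw [gM_card _ _ (by have := π.2; omega)]
    have : ((((π.1.parts.sup : ℤ) - m - 1).toNat : ℤ) + m + 1).toNat = π.1.parts.sup := by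
      have := π.2; omega
    rw [this, fM_gM _ _ (fun i hi => π.1.parts_pos hi)]

lemma card_split {α : Type*} [Finite α] (p r : α → Prop) :
    Nat.card {x // p x} = Nat.card {x // p x ∧ r x} + Nat.card {x // p x ∧ ¬ r x} := by
  classical
  have := Fintype.ofFinite α
  simp only [Nat.card_eq_fintype_card, Fintype.card_subtype]
  rw [← Finset.filter_filter, ← Finset.filter_filter, Finset.card_filter_add_card_filter_not]

lemma card_split' {α : Type*} [Finite α] (r : α → Prop) :
    Nat.card α = Nat.card {x // r x} + Nat.card {x // ¬ r x} := by
  have := card_split (fun _ : α => True) r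
  simpa [Nat.card_congr (Equiv.subtypeUnivEquiv (p := fun _ : α => True) (fun _ => trivial))] using this

lemma card_congr_iff {α : Type*} (p r : α → Prop) (h : ∀ x, p x ↔ r x) :
    Nat.card {x // p x} = Nat.card {x // r x} :=
  Nat.card_congr (Equiv.subtypeEquivRight h)

lemma card_none {α : Type*} (p : α → Prop) (h : ∀ x, ¬ p x) : Nat.card {x // p x} = 0 := by
  have : IsEmpty {x // p x} := ⟨fun x => h x.1 x.2⟩
  exact Nat.card_of_isEmpty

lemma card_le_all {α : Type*} [Finite α] (p : α → Prop) : Nat.card {x // p x} ≤ Nat.card α :=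
  Nat.card_le_card_of_injective _ Subtype.val_injective

/-- number of partitions with rank at least `m` -/
noncomputable def bb (m n : ℕ) : ℕ := Nat.card {π : n.Partition // (m : ℤ) ≤ rank π}

/-- number of partitions with rank at most `-m` -/
noncomputable def dd (m n : ℕ) : ℕ := Nat.card {π : n.Partition // rank π ≤ -(m : ℤ)}

lemma sup_le_n {n : ℕ} (π : n.Partition) : π.parts.sup ≤ n :=
  Multiset.sup_le.2 (fun _ hb => Nat.Partition.le_of_mem_parts hb)

lemma card_le_n {n : ℕ} (π : n.Partition) : π.parts.card ≤ n := by
  have := sum_pred π.parts (fun i hi => π.parts_pos hi)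
  have := π.parts_sum
  omega

lemma parts_ne {n : ℕ} (hn : 0 < n) (π : n.Partition) : π.parts ≠ 0 := by
  intro h
  have := π.parts_sum
  rw [h] at this
  simp at this
  omega

lemma sup_pos' {n : ℕ} (hn : 0 < n) (π : n.Partition) : 0 < π.parts.sup :=
  π.parts_pos (sup_mem _ (parts_ne hn π))

lemma card_pos' {n : ℕ} (hn : 0 < n) (π : n.Partition) : 0 < π.parts.card :=
  Multiset.card_pos.2 (parts_ne hn π)

lemma bb_zero (m n : ℕ) (h : n ≤ m) (h' : 0 < m) : bb m n = 0 := by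
  apply card_none
  intro π hπ
  have h1 := sup_le_n π
  unfold rank at hπ
  rcases Nat.eq_zero_or_pos n with h0 | h0
  · omega
  · have := card_pos' h0 π
    omega

lemma bb_zero' (m n : ℕ) (h : n ≤ m) (h' : 0 < n) : bb m n = 0 := bb_zero m n h (by omega)

lemma dd_zero (m n : ℕ) (h : n ≤ m) (h' : 0 < m) : dd m n = 0 := by
  apply card_none
  intro π hπ
  have h1 := card_le_n π
  unfold rank at hπ
  rcases Nat.eq_zero_or_pos n with h0 | h0
  · omega
  · have := sup_pos' h0 π
    omega

lemma bb_rec (m n : ℕ) : bb m (n + m + 1) + bb (m + 3) n = Nat.card n.Partition := by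
  have h := dyson_bij n (n + m + 1) m (by push_cast; ring)
  have h1 : bb m (n + m + 1) = Nat.card {π : (n + m + 1).Partition //
      (π.parts.card : ℤ) + m ≤ π.parts.sup ∧ 0 ≤ (π.parts.sup : ℤ) - m - 1} := by
    apply card_congr_iff
    intro π
    have := card_pos' (by omega) π
    unfold rank
    omega
  rw [card_split' (fun π : n.Partition => ((m + 3 : ℕ) : ℤ) ≤ rank π), add_comm, h1, ← h]
  unfold bb
  congr 1
  apply card_congr_iff
  intro π
  unfold rank
  push_cast
  omega

lemma dd_rec (m n : ℕ) : dd m (n + m + 1) + dd (m + 3) n = Nat.card n.Partition := by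
  have h := dyson_bij (n + m + 1) n (-m - 2) (by push_cast; ring)
  have h1 : dd m (n + m + 1) = Nat.card {π : (n + m + 1).Partition //
      (π.parts.sup : ℤ) ≤ π.parts.card + (-m - 2) + 2 ∧
        0 ≤ (π.parts.card : ℤ) + (-m - 2) + 1} := by
    apply card_congr_iff
    intro π
    have := sup_pos' (by omega) π
    unfold rank
    omega
  rw [card_split' (fun π : n.Partition => rank π ≤ -((m + 3 : ℕ) : ℤ)), add_comm, h1, h]
  unfold dd
  congr 1
  apply card_congr_iff
  intro π
  unfold rank
  push_cast
  omega

lemma bb_eq_dd (n : ℕ) : ∀ m, (0 < n ∨ 0 < m) → bb m n = dd m n := by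
  induction n using Nat.strong_induction_on with
  | _ n ih =>
    intro m hm
    by_cases h : n ≤ m
    · rw [bb_zero m n h (by omega), dd_zero m n h (by omega)]
    · obtain ⟨k, rfl⟩ : ∃ k, n = k + m + 1 := ⟨n - m - 1, by omega⟩
      have h1 := bb_rec m k
      have h2 := dd_rec m k
      have h3 := ih k (by omega) (m + 3) (by omega)
      omega

lemma rank_card (m : ℤ) (n : ℕ) (hn : 0 < n) :
    Nat.card {π : n.Partition // rank π = m} + bb (m.natAbs + 1) n = bb m.natAbs n := by
  rcases le_total 0 m with h | h
  · unfold bb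
    rw [card_split (fun π : n.Partition => (m.natAbs : ℤ) ≤ rank π) (fun π => rank π = m)]
    congr 1 <;> apply card_congr_iff <;> intro π <;> omega
  · rw [bb_eq_dd _ _ (by omega), bb_eq_dd _ _ (by omega)]
    unfold dd
    rw [card_split (fun π : n.Partition => rank π ≤ -(m.natAbs : ℤ)) (fun π => rank π = m)]
    congr 1 <;> apply card_congr_iff <;> intro π <;> omega

/-- number of partitions with parts at most `k` -/
noncomputable def fk (k n : ℕ) : ℕ := Nat.card {π : n.Partition // ∀ i ∈ π.parts, i ≤ k}

lemma fk_le (k n : ℕ) : fk k n ≤ Nat.card n.Partition := card_le_all _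

lemma fk_eq (k n : ℕ) (h : n ≤ k) : fk k n = Nat.card n.Partition :=
  Nat.card_congr (Equiv.subtypeUnivEquiv
    (fun _ _ hi => (Nat.Partition.le_of_mem_parts hi).trans h))

lemma fk_zero (n : ℕ) : fk 0 n = if n = 0 then 1 else 0 := by
  split_ifs with h
  · subst h
    rw [fk_eq 0 0 le_rfl]
    simp
  · apply card_none
    intro π hπ
    have h1 := hπ _ (sup_mem _ (parts_ne (by omega) π))
    have := sup_pos' (by omega) π
    omega

lemma fk_lt (k n : ℕ) (h : n ≤ k) : fk (k + 1) n = fk k n := by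
  rw [fk_eq k n h, fk_eq _ n (by omega)]

lemma fk_succ (k n : ℕ) : fk (k + 1) (n + (k + 1)) = fk k (n + (k + 1)) + fk (k + 1) n := by
  unfold fk
  rw [card_split (fun π : (n + (k + 1)).Partition => ∀ i ∈ π.parts, i ≤ k + 1)
    (fun π => ¬ (k + 1) ∈ π.parts)]
  congr 1
  · apply card_congr_iff
    intro π
    constructor
    · rintro ⟨h1, h2⟩ i hi
      have := h1 i hi
      have : i ≠ k + 1 := by rintro rfl; exact h2 hi
      omega
    · intro h
      refine ⟨fun i hi => (h i hi).trans (by omega), fun h' => ?_⟩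
      have := h _ h'
      omega
  · refine Nat.card_congr
      { toFun := fun π => ⟨⟨π.1.parts.erase (k + 1),
          fun {i} hi => π.1.parts_pos (Multiset.mem_of_mem_erase hi), ?_⟩, ?_⟩
        invFun := fun π => ⟨⟨(k + 1) ::ₘ π.1.parts, fun {i} hi => ?_, ?_⟩, ?_⟩
        left_inv := ?_
        right_inv := ?_ }
    · have h1 := Multiset.sum_erase (not_not.1 π.2.2)
      have h2 := π.1.parts_sum
      omega
    · intro i hi
      exact π.2.1 i (Multiset.mem_of_mem_erase hi)
    · rcases Multiset.mem_cons.1 hi with h | h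
      · omega
      · exact π.1.parts_pos h
    · rw [Multiset.sum_cons, π.1.parts_sum]; omega
    · refine ⟨fun i hi => ?_, not_not.2 (Multiset.mem_cons_self _ _)⟩
      rcases Multiset.mem_cons.1 hi with h | h
      · omega
      · exact π.2 i h
    · intro π
      apply Subtype.ext
      apply Nat.Partition.ext
      exact Multiset.cons_erase (not_not.1 π.2.2)
    · intro π
      apply Subtype.ext
      apply Nat.Partition.ext
      exact Multiset.erase_cons_head _ _

/-- number of partitions of `n` -/
noncomputable def pn (n : ℕ) : ℕ := Nat.card n.Partition

lemma one_sub_pow_pos {r : ℝ} (hr : |r| < 1) (j : ℕ) : 0 < 1 - r ^ (j + 1) := by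
  have h1 : |r ^ (j + 1)| < 1 := by
    rw [abs_pow]; exact pow_lt_one₀ (abs_nonneg _) hr (by omega)
  have := (abs_lt.1 h1).2
  linarith

lemma summable_norm_pow {r : ℝ} (hr : |r| < 1) : Summable (fun j : ℕ => ‖-r ^ (j + 1)‖) := by
  have : Summable (fun j : ℕ => |r| ^ j) := summable_geometric_of_lt_one (abs_nonneg _) hr
  simpa using (summable_nat_add_iff 1).2 this

lemma euler_ne_zero {r : ℝ} (hr : |r| < 1) : euler r ≠ 0 := by
  have := tprod_one_add_ne_zero_of_summable (f := fun j : ℕ => -r ^ (j + 1))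
    (fun j => by have := one_sub_pow_pos hr j; rw [← sub_eq_add_neg]; exact this.ne')
    (summable_norm_pow hr)
  simpa [euler, sub_eq_add_neg] using this

lemma euler_tendsto {r : ℝ} (hr : |r| < 1) :
    Filter.Tendsto (fun k => ∏ j ∈ Finset.range k, (1 - r ^ (j + 1))) Filter.atTop
      (nhds (euler r)) := by
  have := (multipliable_one_add_of_summable (summable_norm_pow hr)).hasProd.tendsto_prod_nat
  simpa [euler, sub_eq_add_neg] using this

lemma prod_pos {r : ℝ} (hr : |r| < 1) (k : ℕ) :
    0 < ∏ j ∈ Finset.range k, (1 - r ^ (j + 1)) :=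
  Finset.prod_pos (fun j _ => one_sub_pow_pos hr j)

lemma euler_pos {r : ℝ} (hr : |r| < 1) : 0 < euler r :=
  lt_of_le_of_ne (ge_of_tendsto' (euler_tendsto hr) (fun k => (prod_pos hr k).le))
    (euler_ne_zero hr).symm

lemma euler_le {r : ℝ} (h0 : 0 ≤ r) (hr : |r| < 1) (k : ℕ) :
    euler r ≤ ∏ j ∈ Finset.range k, (1 - r ^ (j + 1)) := by
  refine Antitone.le_of_tendsto ?_ (euler_tendsto hr) k
  apply antitone_nat_of_succ_le
  intro n
  rw [Finset.prod_range_succ]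
  have := prod_pos hr n
  have h2 : 0 ≤ r ^ (n + 1) := by positivity
  nlinarith

lemma fk_rec (k n : ℕ) : fk (k + 1) n = fk k n +
    (if k + 1 ≤ n then fk (k + 1) (n - (k + 1)) else 0) := by
  split_ifs with h
  · have := fk_succ k (n - (k + 1))
    rwa [Nat.sub_add_cancel h] at this
  · rw [fk_lt k n (by omega), add_zero]

lemma partial_le {r : ℝ} (h0 : 0 ≤ r) (hr : |r| < 1) (N k : ℕ) :
    (∑ n ∈ Finset.range N, (fk k n : ℝ) * r ^ n) * ∏ j ∈ Finset.range k, (1 - r ^ (j + 1)) ≤ 1 := by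
  induction k with
  | zero =>
    simp only [fk_zero, Finset.range_zero, Finset.prod_empty, mul_one]
    rcases Nat.eq_zero_or_pos N with h | h
    · subst h; simp
    · rw [Finset.sum_eq_single_of_mem 0 (by simpa using h)]
      · simp
      · intro b _ hb; simp [hb]
  | succ k ih =>
    rw [Finset.prod_range_succ]
    set S := ∑ n ∈ Finset.range N, (fk (k + 1) n : ℝ) * r ^ n with hS
    have h1 : S ≤ (∑ n ∈ Finset.range N, (fk k n : ℝ) * r ^ n) + r ^ (k + 1) * S := by
      have e : S = (∑ n ∈ Finset.range N, (fk k n : ℝ) * r ^ n) +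
          ∑ n ∈ Finset.range N,
            ((if k + 1 ≤ n then fk (k + 1) (n - (k + 1)) else 0 : ℕ) : ℝ) * r ^ n := by
        rw [hS, ← Finset.sum_add_distrib]
        apply Finset.sum_congr rfl
        intro n _
        rw [fk_rec k n]
        push_cast
        ring
      have e2 : ∑ n ∈ Finset.range N,
            ((if k + 1 ≤ n then fk (k + 1) (n - (k + 1)) else 0 : ℕ) : ℝ) * r ^ n ≤
          ∑ n ∈ Finset.range ((k + 1) + N),
            ((if k + 1 ≤ n then fk (k + 1) (n - (k + 1)) else 0 : ℕ) : ℝ) * r ^ n := by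
        apply Finset.sum_le_sum_of_subset_of_nonneg
        · intro x hx; simp at *; omega
        · intro i _ _; positivity
      rw [Finset.sum_range_add, Finset.sum_eq_zero (s := Finset.range (k + 1)), zero_add] at e2
      · rw [e]
        rw [← e]
        have e3 : r ^ (k + 1) * S = ∑ n ∈ Finset.range N,
            ((if k + 1 ≤ k + 1 + n then fk (k + 1) (k + 1 + n - (k + 1)) else 0 : ℕ) : ℝ) *
              r ^ (k + 1 + n) := by
          rw [hS, Finset.mul_sum]
          apply Finset.sum_congr rfl
          intro n _
          rw [if_pos (by omega), Nat.add_sub_cancel_left, pow_add]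
          ring
        rw [e3]
        linarith
      · intro x hx
        have : x < k + 1 := by simpa using hx
        rw [if_neg (by omega)]; simp
    have h2 := prod_pos hr k
    calc S * ((∏ j ∈ Finset.range k, (1 - r ^ (j + 1))) * (1 - r ^ (k + 1)))
        = (S - r ^ (k + 1) * S) * ∏ j ∈ Finset.range k, (1 - r ^ (j + 1)) := by ring
      _ ≤ (∑ n ∈ Finset.range N, (fk k n : ℝ) * r ^ n) *
          ∏ j ∈ Finset.range k, (1 - r ^ (j + 1)) := by
        apply mul_le_mul_of_nonneg_right _ h2.le
        linarith
      _ ≤ 1 := ih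

lemma summable_pn_nonneg {r : ℝ} (h0 : 0 ≤ r) (hr : |r| < 1) :
    Summable (fun n => (pn n : ℝ) * r ^ n) := by
  apply summable_of_sum_range_le (c := (euler r)⁻¹)
  · intro n; positivity
  · intro N
    have h1 := partial_le h0 hr N N
    have h2 := euler_le h0 hr N
    have h3 : ∑ n ∈ Finset.range N, (fk N n : ℝ) * r ^ n =
        ∑ n ∈ Finset.range N, (pn n : ℝ) * r ^ n := by
      apply Finset.sum_congr rfl
      intro n hn
      have : n < N := by simpa using hn
      rw [fk_eq N n this.le, pn]
    rw [h3] at h1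
    have h4 : 0 ≤ ∑ n ∈ Finset.range N, (pn n : ℝ) * r ^ n :=
      Finset.sum_nonneg (fun n _ => by positivity)
    rw [← one_div, le_div_iff₀ (euler_pos hr)]
    nlinarith

lemma summable_dom {q : ℝ} (hq : |q| < 1) (a : ℕ → ℕ) (ha : ∀ n, a n ≤ pn n) :
    Summable (fun n => (a n : ℝ) * q ^ n) := by
  refine Summable.of_norm_bounded (summable_pn_nonneg (abs_nonneg q) (by simpa using hq)) ?_
  intro n
  rw [norm_mul, norm_pow, Real.norm_eq_abs, Real.norm_eq_abs, Nat.abs_cast]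
  exact mul_le_mul_of_nonneg_right (by exact_mod_cast ha n) (by positivity)

lemma tsum_shift (g : ℕ → ℝ) (hg : Summable g) (s : ℕ) (h : ∀ n < s, g n = 0) :
    ∑' n, g n = ∑' n, g (n + s) := by
  rw [← hg.sum_add_tsum_nat_add s, Finset.sum_eq_zero, zero_add]
  intro x hx
  exact h x (by simpa using hx)

lemma fk_tsum {q : ℝ} (hq : |q| < 1) (k : ℕ) :
    (∑' n, (fk k n : ℝ) * q ^ n) * ∏ j ∈ Finset.range k, (1 - q ^ (j + 1)) = 1 := by
  induction k with
  | zero =>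
    rw [tsum_eq_single 0]
    · simp [fk_zero]
    · intro b hb; simp [fk_zero, hb]
  | succ k ih =>
    have s1 := summable_dom hq (fk k) (fk_le k)
    have s2 := summable_dom hq (fk (k + 1)) (fk_le (k + 1))
    have e : ∑' n, ((fk (k + 1) n : ℝ) * q ^ n - (fk k n : ℝ) * q ^ n) =
        q ^ (k + 1) * ∑' n, (fk (k + 1) n : ℝ) * q ^ n := by
      rw [tsum_shift _ (s2.sub s1) (k + 1), ← tsum_mul_left]
      · apply tsum_congr
        intro n
        rw [fk_succ, pow_add]
        push_cast
        ring
      · intro n hn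
        rw [fk_lt k n (by omega), sub_self]
    rw [s2.tsum_sub s1] at e
    rw [Finset.prod_range_succ]
    linear_combination (∏ j ∈ Finset.range k, (1 - q ^ (j + 1))) * e + ih

lemma pn_tsum {q : ℝ} (hq : |q| < 1) : ∑' n, (pn n : ℝ) * q ^ n = (euler q)⁻¹ := by
  have h1 : Filter.Tendsto (fun k => ∑' n, (fk k n : ℝ) * q ^ n) Filter.atTop
      (nhds (∑' n, (pn n : ℝ) * q ^ n)) := by
    refine tendsto_tsum_of_dominated_convergence
      (summable_pn_nonneg (abs_nonneg q) (by simpa using hq)) ?_ ?_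
    · intro n
      apply tendsto_const_nhds.congr'
      filter_upwards [Filter.eventually_ge_atTop n] with k hk
      rw [fk_eq k n hk, pn]
    · apply Filter.Eventually.of_forall
      intro k n
      rw [norm_mul, norm_pow, Real.norm_eq_abs, Real.norm_eq_abs, Nat.abs_cast]
      exact mul_le_mul_of_nonneg_right (by exact_mod_cast fk_le k n) (by positivity)
  have h2 := h1.mul (euler_tendsto hq)
  simp only [fk_tsum hq] at h2
  exact eq_inv_of_mul_eq_one_left (tendsto_nhds_unique h2 tendsto_const_nhds)

/-- generating function of partitions with rank at least `m` -/
noncomputable def BQ (q : ℝ) (m : ℕ) : ℝ := ∑' n : ℕ, (bb m (n + 1) : ℝ) * q ^ (n + 1)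

lemma summable_bb {q : ℝ} (hq : |q| < 1) (m : ℕ) :
    Summable (fun n => (bb m n : ℝ) * q ^ n) := summable_dom hq _ (fun _ => card_le_all _)

lemma summable_bb' {q : ℝ} (hq : |q| < 1) (m : ℕ) :
    Summable (fun n => (bb m (n + 1) : ℝ) * q ^ (n + 1)) :=
  (summable_nat_add_iff 1).2 (summable_bb hq m)

lemma BQ_rec {q : ℝ} (hq : |q| < 1) (m : ℕ) :
    BQ q m = q ^ (m + 1) * ((euler q)⁻¹ - BQ q (m + 3)) := by
  have e1 : BQ q (m + 3) = ∑' n, (bb (m + 3) n : ℝ) * q ^ n := by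
    rw [tsum_shift _ (summable_bb hq (m + 3)) 1, BQ]
    intro n hn
    rw [bb_zero (m + 3) n (by omega) (by omega)]; simp
  rw [e1, ← pn_tsum hq,
    ← (summable_dom hq pn (fun _ => le_rfl)).tsum_sub (summable_bb hq (m + 3)), ← tsum_mul_left, BQ,
    tsum_shift _ (summable_bb' hq m) m]
  · apply tsum_congr
    intro n
    have := bb_rec m n
    rw [pn, ← this, add_assoc n m 1, pow_add]
    push_cast
    ring
  · intro n hn
    rw [bb_zero' m (n + 1) (by omega) (by omega)]; simp

lemma BQ_bound {q : ℝ} (hq : |q| < 1) (m : ℕ) : |BQ q m| ≤ (euler |q|)⁻¹ := by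
  have hq' : |(|q|)| < 1 := by simpa using hq
  have s := summable_pn_nonneg (abs_nonneg q) hq'
  rw [← pn_tsum hq', ← Real.norm_eq_abs, BQ]
  have h1 : ‖∑' n : ℕ, (bb m (n + 1) : ℝ) * q ^ (n + 1)‖ ≤
      ∑' n : ℕ, (pn (n + 1) : ℝ) * |q| ^ (n + 1) := by
    refine tsum_of_norm_bounded ((summable_nat_add_iff 1).2 s).hasSum ?_
    intro n
    rw [norm_mul, norm_pow, Real.norm_eq_abs, Real.norm_eq_abs, Nat.abs_cast]
    exact mul_le_mul_of_nonneg_right (by exact_mod_cast card_le_all _) (by positivity)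
  refine h1.trans ?_
  rw [s.tsum_eq_zero_add]
  have : (0 : ℝ) ≤ (pn 0 : ℝ) * |q| ^ 0 := by positivity
  linarith

/-- the exponent -/
def ex (m j : ℕ) : ℕ := (j + 1) * (3 * (j + 1) - 1) / 2 + m * (j + 1)

lemma ex_two (m j : ℕ) : 2 * ex m j = (j + 1) * (3 * j + 2) + 2 * (m * (j + 1)) := by
  have h : 2 ∣ (j + 1) * (3 * (j + 1) - 1) := by
    rw [show 3 * (j + 1) - 1 = 3 * j + 2 by omega]
    rcases Nat.even_or_odd' j with ⟨c, rfl | rfl⟩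
    · exact ⟨(2 * c + 1) * (3 * c + 1), by ring⟩
    · exact ⟨(c + 1) * (3 * (2 * c + 1) + 2), by ring⟩
  unfold ex
  rw [mul_add, Nat.mul_div_cancel' h, show 3 * (j + 1) - 1 = 3 * j + 2 by omega]

lemma ex_zero (m : ℕ) : ex m 0 = m + 1 := by have := ex_two m 0; omega

lemma ex_succ (m j : ℕ) : ex m (j + 1) = m + 1 + ex (m + 3) j := by
  have h1 := ex_two m (j + 1)
  have h2 := ex_two (m + 3) j
  nlinarith

lemma ex_add (m j : ℕ) : ex (m + 1) j = ex m j + (j + 1) := by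
  have h1 := ex_two m j
  have h2 := ex_two (m + 1) j
  nlinarith

lemma ex_ge (m j : ℕ) : j ≤ ex m j := by
  have h1 := ex_two m j
  nlinarith

lemma BQ_iter {q : ℝ} (hq : |q| < 1) (K : ℕ) : ∀ m : ℕ,
    BQ q m = (euler q)⁻¹ * ∑ j ∈ Finset.range (K + 1), (-1 : ℝ) ^ j * q ^ ex m j
      + (-1 : ℝ) ^ (K + 1) * q ^ ex m K * BQ q (m + 3 * (K + 1)) := by
  induction K with
  | zero =>
    intro m
    rw [BQ_rec hq m]
    simp [ex_zero]
    ring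
  | succ K ih =>
    intro m
    rw [BQ_rec hq m, ih (m + 3), Finset.sum_range_succ' _ (K + 1)]
    have e : ∑ j ∈ Finset.range (K + 1), (-1 : ℝ) ^ (j + 1) * q ^ ex m (j + 1) =
        - q ^ (m + 1) * ∑ j ∈ Finset.range (K + 1), (-1 : ℝ) ^ j * q ^ ex (m + 3) j := by
      rw [Finset.mul_sum]
      apply Finset.sum_congr rfl
      intro j _
      rw [ex_succ, pow_add q]
      ring
    rw [e, ex_zero, ex_succ, pow_add q (m + 1) (ex (m + 3) K),
      show m + 3 + 3 * (K + 1) = m + 3 * (K + 1 + 1) by ring]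
    ring

lemma summable_ex {q : ℝ} (hq : |q| < 1) (m : ℕ) :
    Summable (fun j : ℕ => (-1 : ℝ) ^ j * q ^ ex m j) := by
  refine Summable.of_norm_bounded (summable_geometric_of_lt_one (abs_nonneg q) hq) ?_
  intro j
  simp only [norm_mul, norm_pow, norm_neg, norm_one, one_pow, one_mul, Real.norm_eq_abs]
  exact pow_le_pow_of_le_one (abs_nonneg _) hq.le (ex_ge m j)

lemma BQ_eq {q : ℝ} (hq : |q| < 1) (m : ℕ) :
    BQ q m = (euler q)⁻¹ * ∑' j : ℕ, (-1 : ℝ) ^ j * q ^ ex m j := by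
  have h1 := ((summable_ex hq m).hasSum.tendsto_sum_nat.comp
    (Filter.tendsto_add_atTop_nat 1)).const_mul (euler q)⁻¹
  have h2 : Filter.Tendsto
      (fun K : ℕ => (-1 : ℝ) ^ (K + 1) * q ^ ex m K * BQ q (m + 3 * (K + 1)))
      Filter.atTop (nhds 0) := by
    have h3 : Filter.Tendsto (fun K : ℕ => |q| ^ K * (euler |q|)⁻¹) Filter.atTop (nhds 0) := by
      simpa using (tendsto_pow_atTop_nhds_zero_of_lt_one (abs_nonneg q) hq).mul_const (euler |q|)⁻¹
    refine squeeze_zero_norm ?_ h3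
    intro K
    simp only [norm_mul, norm_pow, norm_neg, norm_one, one_pow, one_mul, Real.norm_eq_abs]
    exact mul_le_mul (pow_le_pow_of_le_one (abs_nonneg _) hq.le (ex_ge m K)) (BQ_bound hq _)
      (abs_nonneg _) (by positivity)
  have h4 := h1.add h2
  rw [add_zero] at h4
  refine tendsto_nhds_unique ?_ h4
  refine tendsto_const_nhds.congr ?_
  intro K
  exact BQ_iter hq K m

/-- `P_m(q) = (1/(q;q)_∞) Σ_{j≥1} (-1)^{j-1} (1-q^j) q^{j(3j-1)/2 + |m|j}`. -/
theorem stmt4 (q : ℝ) (hq : |q| < 1) (m : ℤ) :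
    P q m = (euler q)⁻¹ *
      ∑' j : ℕ, (-1 : ℝ) ^ j * (1 - q ^ (j + 1)) *
        q ^ ((j + 1) * (3 * (j + 1) - 1) / 2 + m.natAbs * (j + 1)) := by
  have h1 : P q m = BQ q m.natAbs - BQ q (m.natAbs + 1) := by
    unfold P BQ
    rw [← (summable_bb' hq _).tsum_sub (summable_bb' hq _)]
    apply tsum_congr
    intro n
    rw [← rank_card m (n + 1) (by omega)]
    push_cast
    ring
  rw [h1, BQ_eq hq, BQ_eq hq, ← mul_sub, ← (summable_ex hq _).tsum_sub (summable_ex hq _)]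
  congr 1
  apply tsum_congr
  intro j
  rw [ex_add, pow_add]
  change _ = (-1 : ℝ) ^ j * (1 - q ^ (j + 1)) * q ^ ex m.natAbs j
  ring

end Dyson
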